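/- Convex-split lemma (fidelity bound): Let δ ∈ (0, 1/6). Let ρ_PQ be a density matrix on P×Q and σ_Q a density matrix on Q such that k := Dmax(ρ_PQ ‖ ρ_P ⊗ σ_Q) is finite. Set n := 1 if k ≤ 3δ, and n := ⌈8·2^k·log(k/δ)/δ³⌉ otherwise. Then the convex-split state τ on P×Q₁×…×Qₙ satisfies F(τ_P ⊗ τ_{Q₁…Qₙ}, τ)² ≥ 1 − 6δ, where τ_P and τ_{Q₁…Qₙ} are the marginals of τ on P and on Q₁×…×Qₙ respectively. -/

import Mathlib

open scoped Kronecker BigOperators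
open Matrix
open scoped ComplexOrder Classical

noncomputable section

/-- A density matrix: positive semidefinite with unit trace. -/
def IsDensityMatrix {d : Type*} [Fintype d] (ρ : Matrix d d ℂ) : Prop :=
  ρ.PosSemidef ∧ ρ.trace = 1

/-- Loewner order on Hermitian matrices: `A ≤ B` iff `B - A` is positive semidefinite. -/
def LoewnerLE {d : Type*} [Fintype d] (A B : Matrix d d ℂ) : Prop := (B - A).PosSemidef

/-- Partial trace over the second tensor factor. -/
def ptrace2 {d₁ d₂ : Type*} [Fintype d₂] (M : Matrix (d₁ × d₂) (d₁ × d₂) ℂ) :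
    Matrix d₁ d₁ ℂ :=
  fun i i' => ∑ k, M (i, k) (i', k)

/-- Partial trace over the first tensor factor. -/
def ptrace1 {d₁ d₂ : Type*} [Fintype d₁] (M : Matrix (d₁ × d₂) (d₁ × d₂) ℂ) :
    Matrix d₂ d₂ ℂ :=
  fun j j' => ∑ k, M (k, j) (k, j')

/-- Functional calculus for Hermitian matrices: apply `f` to the eigenvalues. -/
def hermCFC {d : Type*} [Fintype d] [DecidableEq d] (f : ℝ → ℝ) (A : Matrix d d ℂ) :
    Matrix d d ℂ :=
  if hA : A.IsHermitian then
    (hA.eigenvectorUnitary : Matrix d d ℂ) *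
      Matrix.diagonal (fun i => (f (hA.eigenvalues i) : ℂ)) *
      (star (hA.eigenvectorUnitary : Matrix d d ℂ))
  else 0

/-- Matrix logarithm, base 2, applied to nonzero eigenvalues. -/
def matLog2 {d : Type*} [Fintype d] [DecidableEq d] (A : Matrix d d ℂ) : Matrix d d ℂ :=
  hermCFC (Real.logb 2) A

/-- Positive semidefinite square root (via functional calculus). -/
def matSqrt {d : Type*} [Fintype d] [DecidableEq d] (A : Matrix d d ℂ) : Matrix d d ℂ :=
  hermCFC Real.sqrt A

/-- Support containment: the kernel of `σ` is contained in the kernel of `ρ`. -/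
def SupportLE {d : Type*} [Fintype d] (ρ σ : Matrix d d ℂ) : Prop :=
  ∀ v : d → ℂ, σ.mulVec v = 0 → ρ.mulVec v = 0

/-- Relative entropy, base 2, as a real number (meaningful when supports are nested). -/
def relentR {d : Type*} [Fintype d] [DecidableEq d] (ρ σ : Matrix d d ℂ) : ℝ :=
  ((ρ * matLog2 ρ).trace - (ρ * matLog2 σ).trace).re

/-- Relative entropy `D(ρ‖σ)`, base 2, valued in the extended reals: `+∞` unless
the support of `ρ` is contained in the support of `σ`. -/
def relent {d : Type*} [Fintype d] [DecidableEq d] (ρ σ : Matrix d d ℂ) : EReal :=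
  if SupportLE ρ σ then ((relentR ρ σ : ℝ) : EReal) else ⊤

/-- Mutual information `I(A:B)_ρ = D(ρ_AB ‖ ρ_A ⊗ ρ_B)`. -/
def mutInfo {d₁ d₂ : Type*} [Fintype d₁] [Fintype d₂] [DecidableEq d₁] [DecidableEq d₂]
    (ρ : Matrix (d₁ × d₂) (d₁ × d₂) ℂ) : EReal :=
  relent ρ (ptrace2 ρ ⊗ₖ ptrace1 ρ)

/-- Fidelity `F(ρ,σ) = Tr √(√σ ρ √σ)`. -/
def fidelity {d : Type*} [Fintype d] [DecidableEq d] (ρ σ : Matrix d d ℂ) : ℝ :=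
  ((matSqrt (matSqrt σ * ρ * matSqrt σ)).trace).re

/-- Purified distance `P(ρ,σ) = √(1 - F(ρ,σ)²)`. -/
def pdist {d : Type*} [Fintype d] [DecidableEq d] (ρ σ : Matrix d d ℂ) : ℝ :=
  Real.sqrt (1 - (fidelity ρ σ) ^ 2)

/-- Max-relative entropy `Dmax(ρ‖σ) = inf {λ : ρ ≤ 2^λ σ}`, valued in the extended reals. -/
def dmax {d : Type*} [Fintype d] (ρ σ : Matrix d d ℂ) : EReal :=
  sInf {x : EReal | ∃ l : ℝ, x = (l : EReal) ∧ LoewnerLE ρ (((2 : ℝ) ^ l) • σ)}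

/-- Max-information `Imax(A:B)_ρ`. -/
def imax {d₁ d₂ : Type*} [Fintype d₁] [Fintype d₂]
    (ρ : Matrix (d₁ × d₂) (d₁ × d₂) ℂ) : EReal :=
  ⨅ σ : {σ : Matrix d₂ d₂ ℂ // IsDensityMatrix σ}, dmax ρ (ptrace2 ρ ⊗ₖ σ.1)

/-- Smooth max-information `Imax^ε(A:B)_ρ`. -/
def imaxEps {d₁ d₂ : Type*} [Fintype d₁] [Fintype d₂] [DecidableEq d₁] [DecidableEq d₂]
    (ε : ℝ) (ρ : Matrix (d₁ × d₂) (d₁ × d₂) ℂ) : EReal :=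
  ⨅ ρ' : {ρ' : Matrix (d₁ × d₂) (d₁ × d₂) ℂ // IsDensityMatrix ρ' ∧ pdist ρ ρ' ≤ ε},
    imax ρ'.1

/-- The `j`-th term of the convex split: `ρ` on `P` and the `j`-th copy of `Q`, and
`σ` on every other copy of `Q`. -/
def blockState {P Q : Type*} [Fintype Q] [DecidableEq Q]
    (ρ : Matrix (P × Q) (P × Q) ℂ) (σ : Matrix Q Q ℂ) (n : ℕ) (j : Fin n) :
    Matrix (P × (Fin n → Q)) (P × (Fin n → Q)) ℂ :=
  fun x y => ρ (x.1, x.2 j) (y.1, y.2 j) * ∏ i ∈ Finset.univ.erase j, σ (x.2 i) (y.2 i)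

/-- The convex-split state `τ = (1/n) Σ_j ρ_{PQ_j} ⊗ σ_{Q_1} ⊗ ⋯ ⊗ σ_{Q_n}` (omitting `j`). -/
def convexSplit {P Q : Type*} [Fintype Q] [DecidableEq Q]
    (ρ : Matrix (P × Q) (P × Q) ℂ) (σ : Matrix Q Q ℂ) (n : ℕ) :
    Matrix (P × (Fin n → Q)) (P × (Fin n → Q)) ℂ :=
  ((n : ℂ)⁻¹) • ∑ j : Fin n, blockState ρ σ n j

/-- A finite nonempty index type. -/
structure FinIdx where
  carrier : Type
  [fin : Fintype carrier]
  [deq : DecidableEq carrier]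
  [ne : Nonempty carrier]

attribute [instance] FinIdx.fin FinIdx.deq FinIdx.ne

section SpectralCalculus

variable {d : Type*} [Fintype d] [DecidableEq d]

lemma hermCFC_of_isHermitian {A : Matrix d d ℂ} (hA : A.IsHermitian) (f : ℝ → ℝ) :
    hermCFC f A = (hA.eigenvectorUnitary : Matrix d d ℂ) *
      Matrix.diagonal (fun i => (f (hA.eigenvalues i) : ℂ)) *
      (star (hA.eigenvectorUnitary : Matrix d d ℂ)) := by
  simp only [hermCFC, dif_pos hA]

lemma hermCFC_id {A : Matrix d d ℂ} (hA : A.IsHermitian) : hermCFC (fun x => x) A = A := by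
  rw [hermCFC_of_isHermitian hA]
  exact hA.spectral_theorem.symm

lemma hermCFC_congr {A : Matrix d d ℂ} (hA : A.IsHermitian) {f g : ℝ → ℝ}
    (h : ∀ i, f (hA.eigenvalues i) = g (hA.eigenvalues i)) : hermCFC f A = hermCFC g A := by
  simp only [hermCFC_of_isHermitian hA, h]

lemma hermCFC_one {A : Matrix d d ℂ} (hA : A.IsHermitian) : hermCFC (fun _ => 1) A = 1 := by
  simp [hermCFC_of_isHermitian hA]

lemma hermCFC_mul {A : Matrix d d ℂ} (hA : A.IsHermitian) (f g : ℝ → ℝ) :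
    hermCFC f A * hermCFC g A = hermCFC (fun x => f x * g x) A := by
  have hV : star (hA.eigenvectorUnitary : Matrix d d ℂ) * (hA.eigenvectorUnitary : Matrix d d ℂ)
      = 1 := Unitary.coe_star_mul_self _
  simp only [hermCFC_of_isHermitian hA]
  calc _ = (hA.eigenvectorUnitary : Matrix d d ℂ) *
        Matrix.diagonal (fun i => (f (hA.eigenvalues i) : ℂ)) *
        (star (hA.eigenvectorUnitary : Matrix d d ℂ) * (hA.eigenvectorUnitary : Matrix d d ℂ)) *
        Matrix.diagonal (fun i => (g (hA.eigenvalues i) : ℂ)) *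
        (star (hA.eigenvectorUnitary : Matrix d d ℂ)) := by simp only [Matrix.mul_assoc]
    _ = _ := by
      rw [hV, Matrix.mul_one, Matrix.mul_assoc (hA.eigenvectorUnitary : Matrix d d ℂ),
        Matrix.diagonal_mul_diagonal]
      simp

lemma hermCFC_add {A : Matrix d d ℂ} (hA : A.IsHermitian) (f g : ℝ → ℝ) :
    hermCFC f A + hermCFC g A = hermCFC (fun x => f x + g x) A := by
  simp only [hermCFC_of_isHermitian hA, ← Matrix.add_mul, ← Matrix.mul_add,
    Matrix.diagonal_add, Complex.ofReal_add]

lemma hermCFC_sub {A : Matrix d d ℂ} (hA : A.IsHermitian) (f g : ℝ → ℝ) :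
    hermCFC f A - hermCFC g A = hermCFC (fun x => f x - g x) A := by
  rw [sub_eq_iff_eq_add, hermCFC_add hA]
  simp

lemma posSemidef_hermCFC {A : Matrix d d ℂ} (hA : A.IsHermitian) {f : ℝ → ℝ}
    (hf : ∀ i, 0 ≤ f (hA.eigenvalues i)) : (hermCFC f A).PosSemidef := by
  rw [hermCFC_of_isHermitian hA]
  refine Matrix.PosSemidef.mul_mul_conjTranspose_same (Matrix.PosSemidef.diagonal fun i => ?_) _
  simpa using hf i

lemma isHermitian_hermCFC {A : Matrix d d ℂ} (hA : A.IsHermitian) (f : ℝ → ℝ) :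
    (hermCFC f A).IsHermitian := by
  rw [hermCFC_of_isHermitian hA, Matrix.star_eq_conjTranspose]
  refine Matrix.isHermitian_mul_mul_conjTranspose _ ?_
  rw [Matrix.IsHermitian, Matrix.diagonal_conjTranspose]
  congr 1
  ext i
  simp

lemma posSemidef_matSqrt {A : Matrix d d ℂ} (hA : A.PosSemidef) : (matSqrt A).PosSemidef :=
  posSemidef_hermCFC hA.isHermitian fun _ => Real.sqrt_nonneg _

lemma matSqrt_mul_self {A : Matrix d d ℂ} (hA : A.PosSemidef) : matSqrt A * matSqrt A = A := by
  rw [matSqrt, hermCFC_mul hA.isHermitian]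
  conv_rhs => rw [← hermCFC_id hA.isHermitian]
  exact hermCFC_congr _ fun i => Real.mul_self_sqrt (hA.eigenvalues_nonneg i)

/-- A pseudo-inverse of the square root of a positive semidefinite matrix. -/
lemma exists_matSqrt_pinv {A : Matrix d d ℂ} (hA : A.PosSemidef) :
    ∃ s : Matrix d d ℂ, s.IsHermitian ∧ s * matSqrt A = matSqrt A * s ∧
      matSqrt A * s * matSqrt A = matSqrt A := by
  refine ⟨hermCFC (fun x => (Real.sqrt x)⁻¹) A, isHermitian_hermCFC hA.isHermitian _, ?_, ?_⟩
  · simp only [matSqrt, hermCFC_mul hA.isHermitian, mul_comm]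
  · simp only [matSqrt, hermCFC_mul hA.isHermitian]
    exact hermCFC_congr hA.isHermitian fun i => mul_inv_mul_cancel _

/-- Polar and Jordan decompositions of a Hermitian matrix. -/
lemma exists_sign_decomposition {T : Matrix d d ℂ} (hT : T.IsHermitian) :
    ∃ U p q : Matrix d d ℂ, U.IsHermitian ∧ U * U = 1 ∧ p.PosSemidef ∧ q.PosSemidef ∧
      T = p - q ∧ U * T = p + q ∧ T * U = p + q := by
  have key : ∀ x : ℝ, (if 0 ≤ x then 1 else -1 : ℝ) * x = max x 0 + max (-x) 0 := by
    intro x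
    split_ifs with h
    · rw [max_eq_left h, max_eq_right (by linarith)]; ring
    · rw [max_eq_right (by linarith), max_eq_left (by linarith)]; ring
  refine ⟨hermCFC (fun x => if 0 ≤ x then 1 else -1) T, hermCFC (fun x => max x 0) T,
    hermCFC (fun x => max (-x) 0) T, isHermitian_hermCFC hT _, ?_,
    posSemidef_hermCFC hT fun _ => le_max_right _ _,
    posSemidef_hermCFC hT fun _ => le_max_right _ _, ?_, ?_, ?_⟩
  · rw [hermCFC_mul hT, ← hermCFC_one hT]
    refine hermCFC_congr hT fun i => ?_
    split_ifs <;> norm_num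
  · rw [hermCFC_sub hT]
    conv_lhs => rw [← hermCFC_id hT]
    refine hermCFC_congr hT fun i => ?_
    rcases le_total 0 (hT.eigenvalues i) with h | h
    · rw [max_eq_left h, max_eq_right (by linarith)]; ring
    · rw [max_eq_right h, max_eq_left (by linarith)]; ring
  · conv_lhs => rw [← hermCFC_id hT]
    nth_rewrite 1 [hermCFC_id hT]
    rw [hermCFC_mul hT, hermCFC_add hT]
    exact hermCFC_congr hT fun i => key _
  · conv_lhs => rw [← hermCFC_id hT]
    nth_rewrite 2 [hermCFC_id hT]
    rw [hermCFC_mul hT, hermCFC_add hT]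
    exact hermCFC_congr hT fun i => by rw [mul_comm]; exact key _

end SpectralCalculus

section TraceInequalities

lemma trace_re_nonneg {d : Type*} [Fintype d] {A : Matrix d d ℂ} (hA : A.PosSemidef) :
    0 ≤ A.trace.re :=
  (Complex.le_def.1 hA.trace_nonneg).1

variable {d : Type*} [Fintype d] [DecidableEq d]

lemma trace_mul_re_nonneg {A B : Matrix d d ℂ} (hA : A.PosSemidef) (hB : B.PosSemidef) :
    0 ≤ (A * B).trace.re := by
  have h := hA.conjTranspose_mul_mul_same (matSqrt B)
  rw [(posSemidef_matSqrt hB).isHermitian.eq] at h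
  have h' := trace_re_nonneg h
  rwa [Matrix.trace_mul_comm, ← Matrix.mul_assoc, matSqrt_mul_self hB,
    Matrix.trace_mul_comm] at h'

lemma trace_conjTranspose_mul_self_eq_sum {m n : Type*} [Fintype m] [Fintype n]
    (X : Matrix m n ℂ) : (Xᴴ * X).trace = ((∑ i, ∑ j, ‖X j i‖ ^ 2 : ℝ) : ℂ) := by
  simp [Matrix.trace, Matrix.mul_apply, Complex.conj_mul']

/-- Cauchy-Schwarz inequality for the Hilbert-Schmidt inner product. -/
lemma norm_trace_conjTranspose_mul_sq_le {m n : Type*} [Fintype m] [Fintype n]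
    (X Y : Matrix m n ℂ) :
    ‖(Xᴴ * Y).trace‖ ^ 2 ≤ (Xᴴ * X).trace.re * (Yᴴ * Y).trace.re := by
  rw [trace_conjTranspose_mul_self_eq_sum, trace_conjTranspose_mul_self_eq_sum,
    Complex.ofReal_re, Complex.ofReal_re]
  simp only [← Fintype.sum_prod_type']
  have h : ‖(Xᴴ * Y).trace‖ ≤ ∑ x : n × m, ‖X x.2 x.1‖ * ‖Y x.2 x.1‖ := by
    simp only [Matrix.trace, Matrix.diag, Matrix.mul_apply, Matrix.conjTranspose_apply,
      ← Fintype.sum_prod_type']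
    refine (norm_sum_le _ _).trans (le_of_eq ?_)
    simp
  exact (pow_le_pow_left₀ (norm_nonneg _) h 2).trans (Finset.sum_mul_sq_le_sq_mul_sq _ _ _)

/-- The square root is operator monotone. -/
lemma posSemidef_sub_of_mul_self {a b : Matrix d d ℂ} (ha : a.PosSemidef) (hb : b.PosSemidef)
    (h : (b * b - a * a).PosSemidef) : (b - a).PosSemidef := by
  obtain ⟨U, p, q, hU, hUU, hp, hq, hT, hUT, hTU⟩ :=
    exists_sign_decomposition (hb.isHermitian.sub ha.isHermitian)
  have hE : (1 - U).PosSemidef := by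
    have h1 := (Matrix.posSemidef_conjTranspose_mul_self (1 - U)).smul
      (show (0 : ℝ) ≤ 1 / 2 by norm_num)
    have h2 : (1 - U)ᴴ * (1 - U) = (2 : ℝ) • (1 - U) := by
      rw [Matrix.conjTranspose_sub, Matrix.conjTranspose_one, hU.eq, two_smul]
      simp only [mul_sub, sub_mul, hUU, mul_one, one_mul]
      abel
    rwa [h2, smul_smul, show (1 / 2 * 2 : ℝ) = 1 by norm_num, one_smul] at h1
  have e1 : (1 - U) * (b - a) = -(2 : ℝ) • q := by
    rw [sub_mul, hUT, one_mul, hT, neg_smul, two_smul]; abel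
  have e2 : (b - a) * (1 - U) = -(2 : ℝ) • q := by
    rw [mul_sub, hTU, mul_one, hT, neg_smul, two_smul]; abel
  have e3 : ((1 - U) * (b * b - a * a)).trace = -(2 : ℝ) • ((q * b).trace + (q * a).trace) := by
    have : (1 - U) * (b * b - a * a) = (1 - U) * (b * (b - a)) + (1 - U) * (b - a) * a := by
      noncomm_ring
    rw [this, Matrix.trace_add, ← Matrix.mul_assoc, Matrix.trace_mul_comm, ← Matrix.mul_assoc, e1,
      e2, Matrix.smul_mul, Matrix.smul_mul, Matrix.trace_smul, Matrix.trace_smul, smul_add]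
  have h1 := trace_mul_re_nonneg hE h
  rw [e3] at h1
  have h2 := trace_mul_re_nonneg hq ha
  have h3 := trace_mul_re_nonneg hq hb
  simp at h1
  have h4 : (p * q).trace = 0 := by
    have h5 : (p + q) * (p + q) = (p - q) * (p - q) := by
      calc (p + q) * (p + q) = (b - a) * U * (U * (b - a)) := by rw [hTU, hUT]
        _ = (b - a) * (U * U) * (b - a) := by simp only [Matrix.mul_assoc]
        _ = (p - q) * (p - q) := by rw [hUU, Matrix.mul_one, hT]
    have h6 := congrArg Matrix.trace h5
    simp only [add_mul, mul_add, sub_mul, mul_sub, Matrix.trace_add, Matrix.trace_sub,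
      Matrix.trace_mul_comm q p] at h6
    linear_combination (1 / 4) * h6
  have h7 : (q * q).trace.re = -((q * b).trace.re - (q * a).trace.re) := by
    have h8 := congrArg (fun X => (q * X).trace) hT
    simp only [mul_sub, Matrix.trace_sub, Matrix.trace_mul_comm q p, h4] at h8
    rw [← Complex.sub_re, h8]
    simp
  have h9 : q = 0 := by
    rw [← Matrix.trace_conjTranspose_mul_self_eq_zero_iff, hq.isHermitian.eq]
    have h10 := (Matrix.posSemidef_conjTranspose_mul_self q).trace_nonneg
    rw [hq.isHermitian.eq] at h10
    refine Complex.ext ?_ (Complex.le_def.1 h10).2.symm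
    rw [h7, Complex.zero_re]
    linarith
  rw [hT, h9, sub_zero]
  exact hp

lemma re_trace_le_trace_matSqrt (X : Matrix d d ℂ) :
    X.trace.re ≤ (matSqrt (Xᴴ * X)).trace.re := by
  have hA := (Matrix.posSemidef_conjTranspose_mul_self X).isHermitian
  set V : Matrix d d ℂ := (hA.eigenvectorUnitary : Matrix d d ℂ) with hV
  have hV1 : star V * V = 1 := Unitary.coe_star_mul_self _
  have hV2 : V * star V = 1 := Unitary.coe_mul_star_self _
  have hspec : Xᴴ * X = V * Matrix.diagonal (fun i => (hA.eigenvalues i : ℂ)) * star V :=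
    hA.spectral_theorem
  have hY : (star V * X * V)ᴴ * (star V * X * V) =
      Matrix.diagonal (fun i => (hA.eigenvalues i : ℂ)) := by
    calc (star V * X * V)ᴴ * (star V * X * V) = star V * (Xᴴ * ((V * star V) * X)) * V := by
          simp only [Matrix.conjTranspose_mul, Matrix.star_eq_conjTranspose,
            Matrix.conjTranspose_conjTranspose, Matrix.mul_assoc]
      _ = (star V * V) * Matrix.diagonal (fun i => (hA.eigenvalues i : ℂ)) * (star V * V) := by
          rw [hV2, Matrix.one_mul]
          conv_lhs => rw [hspec]
          simp only [Matrix.mul_assoc]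
      _ = _ := by rw [hV1, Matrix.one_mul, Matrix.mul_one]
  have htr : X.trace = (star V * X * V).trace := by
    rw [Matrix.trace_mul_comm, ← Matrix.mul_assoc, hV2, Matrix.one_mul]
  have htr2 : (matSqrt (Xᴴ * X)).trace.re = ∑ i, Real.sqrt (hA.eigenvalues i) := by
    rw [matSqrt, hermCFC_of_isHermitian hA, Matrix.trace_mul_comm, ← Matrix.mul_assoc, ← hV, hV1,
      Matrix.one_mul, Matrix.trace_diagonal, Complex.re_sum]
    simp
  rw [htr, htr2, Matrix.trace, Complex.re_sum]
  refine Finset.sum_le_sum fun i _ => Real.le_sqrt_of_sq_le ?_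
  have h1 := congrArg (fun M : Matrix d d ℂ => (M i i).re) hY
  simp only [Matrix.mul_apply (M := (star V * X * V)ᴴ), Matrix.conjTranspose_apply,
    Matrix.diagonal_apply_eq, Complex.ofReal_re, Complex.re_sum] at h1
  rw [← h1]
  have h2 : ∀ z : ℂ, (star z * z).re = Complex.normSq z := fun z => by
    rw [Complex.star_def, ← Complex.normSq_eq_conj_mul_self, Complex.ofReal_re]
  simp only [h2]
  refine le_trans ?_ (Finset.single_le_sum (f := fun j => Complex.normSq ((star V * X * V) j i))
    (fun j _ => Complex.normSq_nonneg _) (Finset.mem_univ i))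
  simp only [Matrix.diag, Complex.normSq_apply]
  nlinarith [mul_self_nonneg ((star V * X * V) i i).im]

/-- The fidelity is bounded below by the overlap of Hermitian square roots. -/
lemma re_trace_mul_matSqrt_le_fidelity {ρ τ c : Matrix d d ℂ} (hτ : τ.PosSemidef)
    (hc : c.IsHermitian) (hcc : c * c = ρ) : (c * matSqrt τ).trace.re ≤ fidelity ρ τ := by
  have h := re_trace_le_trace_matSqrt (c * matSqrt τ)
  have e : (c * matSqrt τ)ᴴ * (c * matSqrt τ) = matSqrt τ * ρ * matSqrt τ := by
    rw [Matrix.conjTranspose_mul, hc.eq, (posSemidef_matSqrt hτ).isHermitian.eq, ← hcc]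
    simp only [Matrix.mul_assoc]
  rw [e] at h
  exact h

/-- Variational form of the Powers-Størmer inequality. -/
lemma exists_unitary_trace_sub_sq_le {a b : Matrix d d ℂ} (ha : a.PosSemidef)
    (hb : b.PosSemidef) :
    ∃ U : Matrix d d ℂ, Uᴴ * U = 1 ∧
      ((a - b) * (a - b)).trace.re ≤ (U * (a * a - b * b)).trace.re := by
  obtain ⟨U, p, q, hU, hUU, hp, hq, hT, hUT, hTU⟩ :=
    exists_sign_decomposition (ha.isHermitian.sub hb.isHermitian)
  refine ⟨U, by rw [hU.eq, hUU], ?_⟩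
  have e1 : (U * (a * a - b * b)).trace = ((p + q) * (a + b)).trace := by
    have : U * (a * a - b * b) = U * a * (a - b) + U * (a - b) * b := by noncomm_ring
    rw [this, Matrix.trace_add, Matrix.trace_mul_comm (U * a), ← Matrix.mul_assoc, hTU, hUT,
      mul_add, Matrix.trace_add]
  have e2 : ((p + q) * (a + b)).trace.re - ((a - b) * (a - b)).trace.re =
      2 * (p * b).trace.re + 2 * (q * a).trace.re := by
    have : (a - b) * (a - b) = (p - q) * (a - b) := by rw [← hT]
    rw [this]
    simp only [add_mul, mul_add, sub_mul, mul_sub, Matrix.trace_add, Matrix.trace_sub,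
      Complex.add_re, Complex.sub_re]
    ring
  rw [e1]
  linarith [trace_mul_re_nonneg hp hb, trace_mul_re_nonneg hq ha]

end TraceInequalities

section PartialTrace

variable {P R : Type*}

lemma trace_ptrace2 [Fintype P] [Fintype R] (M : Matrix (P × R) (P × R) ℂ) :
    (ptrace2 M).trace = M.trace := by
  simp [Matrix.trace, ptrace2, Fintype.sum_prod_type]

lemma trace_ptrace1 [Fintype P] [Fintype R] (M : Matrix (P × R) (P × R) ℂ) :
    (ptrace1 M).trace = M.trace := by
  simp [Matrix.trace, ptrace1, Fintype.sum_prod_type_right]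

lemma ptrace1_sub [Fintype P] (M N : Matrix (P × R) (P × R) ℂ) :
    ptrace1 (M - N) = ptrace1 M - ptrace1 N := by
  ext i j
  simp [ptrace1]

lemma ptrace1_smul [Fintype P] (c : ℝ) (M : Matrix (P × R) (P × R) ℂ) :
    ptrace1 (c • M) = c • ptrace1 M := by
  ext i j
  simp [ptrace1, Finset.mul_sum]

lemma ptrace1_kronecker [Fintype P] (A : Matrix P P ℂ) (B : Matrix R R ℂ) :
    ptrace1 (A ⊗ₖ B) = A.trace • B := by
  ext i j
  simp [ptrace1, Matrix.trace, Finset.sum_mul]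

lemma ptrace2_kronecker [Fintype R] (A : Matrix P P ℂ) (B : Matrix R R ℂ) :
    ptrace2 (A ⊗ₖ B) = B.trace • A := by
  ext i j
  simp [ptrace2, Matrix.trace, Finset.mul_sum, mul_comm]

lemma posSemidef_ptrace1 [Fintype P] {M : Matrix (P × R) (P × R) ℂ} (hM : M.PosSemidef) :
    (ptrace1 M).PosSemidef := by
  have : ptrace1 M = ∑ p, M.submatrix (fun r => (p, r)) (fun r => (p, r)) := by
    ext i j
    simp [ptrace1, Matrix.sum_apply]
  rw [this]
  exact Matrix.posSemidef_sum _ fun p _ => hM.submatrix _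

lemma posSemidef_ptrace2 [Fintype R] {M : Matrix (P × R) (P × R) ℂ} (hM : M.PosSemidef) :
    (ptrace2 M).PosSemidef := by
  have : ptrace2 M = ∑ r, M.submatrix (fun p => (p, r)) (fun p => (p, r)) := by
    ext i j
    simp [ptrace2, Matrix.sum_apply]
  rw [this]
  exact Matrix.posSemidef_sum _ fun p _ => hM.submatrix _

lemma IsDensityMatrix.ptrace1 [Fintype P] [Fintype R] {M : Matrix (P × R) (P × R) ℂ}
    (hM : IsDensityMatrix M) : IsDensityMatrix (ptrace1 M) :=
  ⟨posSemidef_ptrace1 hM.1, (trace_ptrace1 M).trans hM.2⟩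

lemma IsDensityMatrix.ptrace2 [Fintype P] [Fintype R] {M : Matrix (P × R) (P × R) ℂ}
    (hM : IsDensityMatrix M) : IsDensityMatrix (ptrace2 M) :=
  ⟨posSemidef_ptrace2 hM.1, (trace_ptrace2 M).trans hM.2⟩

lemma IsDensityMatrix.kronecker [Fintype P] [Fintype R] {A : Matrix P P ℂ} {B : Matrix R R ℂ}
    (hA : IsDensityMatrix A) (hB : IsDensityMatrix B) : IsDensityMatrix (A ⊗ₖ B) :=
  ⟨hA.1.kronecker hB.1, by rw [Matrix.trace_kronecker, hA.2, hB.2, one_mul]⟩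

lemma posSemidef_smul_sub_ptrace1 [Fintype P] {ρ : Matrix (P × R) (P × R) ℂ} {A : Matrix P P ℂ}
    {σ : Matrix R R ℂ} (hA : A.trace = 1) {c : ℝ} (h : (c • (A ⊗ₖ σ) - ρ).PosSemidef) :
    (c • σ - ptrace1 ρ).PosSemidef := by
  have h' := posSemidef_ptrace1 h
  rwa [ptrace1_sub, ptrace1_smul, ptrace1_kronecker, hA, one_smul] at h'

end PartialTrace

section Fidelity

variable {d : Type*} [Fintype d] [DecidableEq d]

/-- If `ρ ≤ c • ω` for density matrices then `√ρ ≤ √c • √ω`, and the difference is small. -/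
lemma sqrt_gap {ρ ω a b : Matrix d d ℂ} (hρ : IsDensityMatrix ρ) (hω : IsDensityMatrix ω)
    (ha : a.PosSemidef) (hb : b.PosSemidef) (haa : a * a = ρ) (hbb : b * b = ω) {c : ℝ}
    (hc : 0 ≤ c) (h : (c • ω - ρ).PosSemidef) :
    (Real.sqrt c • b - a).PosSemidef ∧
      ((Real.sqrt c • b - a) * (Real.sqrt c • b - a)).trace.re ≤ c - 1 := by
  have hqb : (Real.sqrt c • b).PosSemidef := hb.smul (Real.sqrt_nonneg c)
  have hpos : (Real.sqrt c • b - a).PosSemidef := by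
    refine posSemidef_sub_of_mul_self ha hqb ?_
    rwa [Matrix.smul_mul, Matrix.mul_smul, smul_smul, Real.mul_self_sqrt hc, hbb, haa]
  refine ⟨hpos, ?_⟩
  have h1 := trace_mul_re_nonneg ha hpos
  have ta : (a * a).trace.re = 1 := by rw [haa, hρ.2, Complex.one_re]
  have tb : (b * b).trace.re = 1 := by rw [hbb, hω.2, Complex.one_re]
  simp only [mul_sub, sub_mul, Matrix.trace_sub, Complex.sub_re, Matrix.mul_smul, Matrix.smul_mul,
    Matrix.trace_smul, Complex.smul_re, smul_eq_mul, ta, tb, Matrix.trace_mul_comm b a] at h1 ⊢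
  nlinarith [Real.mul_self_sqrt hc]

lemma two_sub_le_fidelity_of_le {P R : Type*} [Fintype P] [Fintype R] [DecidableEq P]
    [DecidableEq R] {τ : Matrix (P × R) (P × R) ℂ} (hτ : IsDensityMatrix τ) {s : Matrix R R ℂ}
    (hs : IsDensityMatrix s) {c : ℝ} (hc : 0 ≤ c)
    (h : (c • (ptrace2 τ ⊗ₖ s) - τ).PosSemidef) :
    2 - c ≤ fidelity (ptrace2 τ ⊗ₖ ptrace1 τ) τ := by
  have hA := hτ.ptrace2
  have hR := hτ.ptrace1
  set a := matSqrt τ with ha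
  set x := matSqrt (ptrace2 τ) with hx
  set y := matSqrt (ptrace1 τ) with hy
  set z := matSqrt s with hz
  have pa : a.PosSemidef := posSemidef_matSqrt hτ.1
  have px : x.PosSemidef := posSemidef_matSqrt hA.1
  have py : y.PosSemidef := posSemidef_matSqrt hR.1
  have pz : z.PosSemidef := posSemidef_matSqrt hs.1
  have haa : a * a = τ := matSqrt_mul_self hτ.1
  have hxx : x * x = ptrace2 τ := matSqrt_mul_self hA.1
  have hyy : y * y = ptrace1 τ := matSqrt_mul_self hR.1
  have hzz : z * z = s := matSqrt_mul_self hs.1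
  have hbb : (x ⊗ₖ z) * (x ⊗ₖ z) = ptrace2 τ ⊗ₖ s := by
    rw [← Matrix.mul_kronecker_mul, hxx, hzz]
  have hcc : (x ⊗ₖ y) * (x ⊗ₖ y) = ptrace2 τ ⊗ₖ ptrace1 τ := by
    rw [← Matrix.mul_kronecker_mul, hxx, hyy]
  obtain ⟨he, he'⟩ := sqrt_gap hτ (hA.kronecker hs) pa (px.kronecker pz) haa hbb hc h
  obtain ⟨hf, hf'⟩ := sqrt_gap hR hs py pz hyy hzz hc (posSemidef_smul_sub_ptrace1 hA.2 h)
  set e := Real.sqrt c • (x ⊗ₖ z) - a with hedef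
  set f := Real.sqrt c • z - y with hfdef
  have hg := trace_mul_re_nonneg (px.kronecker hf) he
  have hgg : ((x ⊗ₖ f) * (x ⊗ₖ f)).trace.re ≤ c - 1 := by
    rwa [← Matrix.mul_kronecker_mul, Matrix.trace_kronecker, hxx, hA.2, one_mul]
  have hdiff : x ⊗ₖ y - a = e - x ⊗ₖ f := by
    rw [hedef, hfdef, sub_eq_add_neg _ y, Matrix.kronecker_add, Matrix.kronecker_smul]
    have : x ⊗ₖ (-y) = -(x ⊗ₖ y) := by
      ext; simp
    rw [this]
    abel
  have hsq := congrArg (fun M => (M * M).trace.re) hdiff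
  have ta : (a * a).trace.re = 1 := by rw [haa, hτ.2, Complex.one_re]
  have tc : ((x ⊗ₖ y) * (x ⊗ₖ y)).trace.re = 1 := by
    rw [hcc, (hA.kronecker hR).2, Complex.one_re]
  simp only [mul_sub, sub_mul, Matrix.trace_sub, Complex.sub_re, ta, tc,
    Matrix.trace_mul_comm a, Matrix.trace_mul_comm e (x ⊗ₖ f)] at hsq
  have hF := re_trace_mul_matSqrt_le_fidelity hτ.1 (px.kronecker py).isHermitian hcc
  rw [← ha] at hF
  linarith

/-- If all unitary test values on `ρ - τ` are small then the fidelity is large. -/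
lemma one_sub_le_fidelity_of_unitary_bound {ρ τ : Matrix d d ℂ} (hρ : IsDensityMatrix ρ)
    (hτ : IsDensityMatrix τ) {ε : ℝ}
    (h : ∀ U : Matrix d d ℂ, Uᴴ * U = 1 → ‖(U * (ρ - τ)).trace‖ ≤ 2 * ε) :
    1 - ε ≤ fidelity ρ τ := by
  have pa := posSemidef_matSqrt hρ.1
  have pb := posSemidef_matSqrt hτ.1
  obtain ⟨U, hU, hle⟩ := exists_unitary_trace_sub_sq_le pa pb
  have h1 := (Complex.re_le_norm _).trans (h U hU)
  rw [matSqrt_mul_self hρ.1, matSqrt_mul_self hτ.1] at hle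
  simp only [mul_sub, sub_mul, Matrix.trace_sub, Complex.sub_re, matSqrt_mul_self hρ.1,
    matSqrt_mul_self hτ.1, hρ.2, hτ.2, Complex.one_re,
    Matrix.trace_mul_comm (matSqrt τ) (matSqrt ρ)] at hle h1
  have hF := re_trace_mul_matSqrt_le_fidelity hτ.1 pa.isHermitian (matSqrt_mul_self hρ.1)
  linarith

end Fidelity

section ConvexSplit

/-- The `n`-fold tensor power of a matrix. -/
def tensorPow {Q : Type*} (n : ℕ) (σ : Matrix Q Q ℂ) : Matrix (Fin n → Q) (Fin n → Q) ℂ :=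
  fun x y => ∏ i, σ (x i) (y i)

variable {P Q : Type*} [Fintype Q] [DecidableEq Q] {n : ℕ}

lemma sum_prod_apply_eq {ι κ : Type*} [Fintype ι] [DecidableEq ι] [Fintype κ] (g : ι → κ → ℂ) :
    ∑ z : ι → κ, ∏ i, g i (z i) = ∏ i, ∑ q, g i q := by
  rw [Finset.prod_univ_sum, Fintype.piFinset_univ]

/-- Sums over product index types of site-wise products in which one site is singled out. -/
lemma sum_mul_prod_erase {ι κ : Type*} [Fintype ι] [DecidableEq ι] [Fintype κ] (j : ι)
    (a : κ → ℂ) (g : ι → κ → ℂ) :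
    ∑ z : ι → κ, a (z j) * ∏ i ∈ Finset.univ.erase j, g i (z i) =
      (∑ q, a q) * ∏ i ∈ Finset.univ.erase j, ∑ q, g i q := by
  calc _ = ∑ z : ι → κ, ∏ i, (if i = j then a (z i) else g i (z i)) := by
        refine Finset.sum_congr rfl fun z _ => ?_
        rw [← Finset.mul_prod_erase _ _ (Finset.mem_univ j), if_pos rfl]
        congr 1
        exact Finset.prod_congr rfl fun i hi => by rw [if_neg (Finset.ne_of_mem_erase hi)]
    _ = _ := by
        rw [sum_prod_apply_eq (fun i q => if i = j then a q else g i q),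
          ← Finset.mul_prod_erase _ _ (Finset.mem_univ j)]
        simp only [if_true]
        congr 1
        exact Finset.prod_congr rfl fun i hi => by simp only [if_neg (Finset.ne_of_mem_erase hi)]

lemma blockState_mul [Fintype P] (L K : Matrix (P × Q) (P × Q) ℂ) (s t : Matrix Q Q ℂ)
    (j : Fin n) :
    blockState L s n j * blockState K t n j = blockState (L * K) (s * t) n j := by
  ext ⟨p, x⟩ ⟨p', y⟩
  simp only [Matrix.mul_apply, blockState, Fintype.sum_prod_type, Finset.sum_mul]
  refine Finset.sum_congr rfl fun p'' _ => ?_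
  rw [← Finset.sum_mul, ← sum_mul_prod_erase j (fun q => L (p, x j) (p'', q) * K (p'', q) (p', y j))
    (fun i q => s (x i) q * t q (y i))]
  refine Finset.sum_congr rfl fun z _ => ?_
  rw [Finset.prod_mul_distrib]
  ring

lemma conjTranspose_blockState (K : Matrix (P × Q) (P × Q) ℂ) (t : Matrix Q Q ℂ) (j : Fin n) :
    (blockState K t n j)ᴴ = blockState Kᴴ tᴴ n j := by
  ext x y
  simp [blockState, Matrix.conjTranspose_apply]

lemma blockState_sub (K L : Matrix (P × Q) (P × Q) ℂ) (σ : Matrix Q Q ℂ) (j : Fin n) :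
    blockState (K - L) σ n j = blockState K σ n j - blockState L σ n j := by
  ext x y
  simp [blockState, sub_mul]

lemma blockState_kronecker (A : Matrix P P ℂ) (σ : Matrix Q Q ℂ) (j : Fin n) :
    blockState (A ⊗ₖ σ) σ n j = A ⊗ₖ tensorPow n σ := by
  ext x y
  simp only [blockState, Matrix.kroneckerMap_apply, tensorPow]
  rw [← Finset.mul_prod_erase _ _ (Finset.mem_univ j), mul_assoc]

lemma sum_sum_prod_apply_eq {ι κ : Type*} [Fintype ι] [DecidableEq ι] [Fintype κ]
    (g : ι → κ → κ → ℂ) :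
    ∑ x : ι → κ, ∑ y : ι → κ, ∏ i, g i (x i) (y i) = ∏ i, ∑ q, ∑ q', g i q q' := by
  simp_rw [fun x : ι → κ => sum_prod_apply_eq (fun i q => g i (x i) q)]
  exact sum_prod_apply_eq (fun i q => ∑ q', g i q q')

/-- Hilbert-Schmidt inner products of block matrices factorize over the sites. -/
lemma trace_conjTranspose_blockState_mul [Fintype P] (K : Matrix (P × Q) (P × Q) ℂ)
    (t : Matrix Q Q ℂ) (i j : Fin n) :
    ((blockState K t n i)ᴴ * blockState K t n j).trace = ∑ p', ∑ p, ∏ l, ∑ q', ∑ q,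
      star (if l = i then K (p, q) (p', q') else t q q') *
        (if l = j then K (p, q) (p', q') else t q q') := by
  have hblock : ∀ (k : Fin n) (p p' : P) (x y : Fin n → Q),
      blockState K t n k (p, x) (p', y) =
        ∏ l, if l = k then K (p, x l) (p', y l) else t (x l) (y l) := by
    intro k p p' x y
    rw [← Finset.mul_prod_erase _ _ (Finset.mem_univ k), if_pos rfl]
    exact congrArg _ (Finset.prod_congr rfl fun l hl => by rw [if_neg (Finset.ne_of_mem_erase hl)])
  simp only [Matrix.trace, Matrix.diag, Matrix.mul_apply, Matrix.conjTranspose_apply,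
    Fintype.sum_prod_type, hblock]
  refine Finset.sum_congr rfl fun p' _ => ?_
  rw [Finset.sum_comm]
  refine Finset.sum_congr rfl fun p _ => ?_
  rw [← sum_sum_prod_apply_eq (fun l q' q =>
    star (if l = i then K (p, q) (p', q') else t q q') *
        (if l = j then K (p, q) (p', q') else t q q'))]
  simp only [Finset.prod_mul_distrib, star_prod]

lemma trace_conjTranspose_blockState_mul_of_ne [Fintype P] (K : Matrix (P × Q) (P × Q) ℂ)
    (t : Matrix Q Q ℂ)
    (hK : ∀ p p', ∑ q', ∑ q, star (t q q') * K (p, q) (p', q') = 0) {i j : Fin n} (hij : i ≠ j) :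
    ((blockState K t n i)ᴴ * blockState K t n j).trace = 0 := by
  rw [trace_conjTranspose_blockState_mul]
  refine Finset.sum_eq_zero fun p' _ => Finset.sum_eq_zero fun p _ =>
    Finset.prod_eq_zero (Finset.mem_univ j) ?_
  simpa [hij.symm] using hK p p'

lemma trace_conjTranspose_blockState_mul_self [Fintype P] (K : Matrix (P × Q) (P × Q) ℂ)
    (t : Matrix Q Q ℂ) (ht : (tᴴ * t).trace = 1) (j : Fin n) :
    ((blockState K t n j)ᴴ * blockState K t n j).trace = (Kᴴ * K).trace := by
  rw [trace_conjTranspose_blockState_mul]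
  simp only [Matrix.trace, Matrix.diag, Matrix.mul_apply, Matrix.conjTranspose_apply,
    Fintype.sum_prod_type] at ht ⊢
  refine Finset.sum_congr rfl fun p' _ => ?_
  rw [Finset.sum_comm]
  refine Finset.sum_congr rfl fun p _ => ?_
  rw [← Finset.mul_prod_erase _ _ (Finset.mem_univ j), Finset.prod_eq_one, mul_one]
  · simp
  · intro l hl
    simpa [Finset.ne_of_mem_erase hl] using ht

lemma isDensityMatrix_blockState [Fintype P] [DecidableEq P] {ρ : Matrix (P × Q) (P × Q) ℂ}
    {σ : Matrix Q Q ℂ} (hρ : IsDensityMatrix ρ) (hσ : IsDensityMatrix σ) (j : Fin n) :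
    IsDensityMatrix (blockState ρ σ n j) := by
  have h : blockState ρ σ n j =
      (blockState (matSqrt ρ) (matSqrt σ) n j)ᴴ * blockState (matSqrt ρ) (matSqrt σ) n j := by
    rw [conjTranspose_blockState, blockState_mul, (posSemidef_matSqrt hρ.1).isHermitian.eq,
      (posSemidef_matSqrt hσ.1).isHermitian.eq, matSqrt_mul_self hρ.1, matSqrt_mul_self hσ.1]
  refine ⟨by rw [h]; exact Matrix.posSemidef_conjTranspose_mul_self _, ?_⟩
  rw [h, trace_conjTranspose_blockState_mul_self, (posSemidef_matSqrt hρ.1).isHermitian.eq,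
    matSqrt_mul_self hρ.1, hρ.2]
  rw [(posSemidef_matSqrt hσ.1).isHermitian.eq, matSqrt_mul_self hσ.1, hσ.2]

lemma isDensityMatrix_convexSplit [Fintype P] [DecidableEq P] {ρ : Matrix (P × Q) (P × Q) ℂ}
    {σ : Matrix Q Q ℂ} (hρ : IsDensityMatrix ρ) (hσ : IsDensityMatrix σ) (hn : n ≠ 0) :
    IsDensityMatrix (convexSplit ρ σ n) := by
  constructor
  · refine (Matrix.posSemidef_sum _ fun j _ => (isDensityMatrix_blockState hρ hσ j).1).smul ?_
    rw [← Complex.ofReal_natCast, ← Complex.ofReal_inv]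
    exact Complex.zero_le_real.2 (by positivity)
  · rw [convexSplit, Matrix.trace_smul, Matrix.trace_sum,
      Finset.sum_congr rfl fun j _ => (isDensityMatrix_blockState hρ hσ j).2]
    simp [hn]

lemma ptrace2_convexSplit (ρ : Matrix (P × Q) (P × Q) ℂ) {σ : Matrix Q Q ℂ} (hσ : σ.trace = 1)
    (hn : n ≠ 0) : ptrace2 (convexSplit ρ σ n) = ptrace2 ρ := by
  ext p p'
  have hσ' : ∑ q, σ q q = 1 := hσ
  have h : ∀ j : Fin n, ∑ x, blockState ρ σ n j (p, x) (p', x) = ptrace2 ρ p p' := fun j => by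
    simp only [blockState, ptrace2]
    rw [sum_mul_prod_erase j (fun q => ρ (p, q) (p', q)) (fun _ q => σ q q),
      Finset.prod_eq_one (fun _ _ => hσ'), mul_one]
  simp only [convexSplit, ptrace2, Matrix.smul_apply, Matrix.sum_apply, smul_eq_mul,
    ← Finset.mul_sum]
  rw [Finset.sum_comm, Finset.sum_congr rfl fun j _ => h j]
  simp [hn, ptrace2]

lemma kronecker_ptrace1_convexSplit [Fintype P] (A : Matrix P P ℂ) (ρ : Matrix (P × Q) (P × Q) ℂ)
    (σ : Matrix Q Q ℂ) :
    A ⊗ₖ ptrace1 (convexSplit ρ σ n) = convexSplit (A ⊗ₖ ptrace1 ρ) σ n := by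
  ext ⟨p, x⟩ ⟨p', y⟩
  simp only [convexSplit, ptrace1, Matrix.smul_apply, Matrix.sum_apply, smul_eq_mul, blockState,
    Matrix.kroneckerMap_apply, ← Finset.mul_sum]
  rw [Finset.sum_comm, mul_left_comm, Finset.mul_sum]
  simp only [Finset.mul_sum, Finset.sum_mul, mul_assoc]

end ConvexSplit

section SecondMoment

variable {d : Type*} [Fintype d] [DecidableEq d]

lemma mul_eq_zero_of_smul_sub_posSemidef {ρ M N : Matrix d d ℂ} (hρ : ρ.PosSemidef) {c : ℝ}
    (h : (c • M - ρ).PosSemidef) (hMN : M * N = 0) : ρ * N = 0 := by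
  have pr := posSemidef_matSqrt hρ
  have h1 := (h.conjTranspose_mul_mul_same N).trace_nonneg
  have h2 : Nᴴ * (c • M - ρ) * N = -((matSqrt ρ * N)ᴴ * (matSqrt ρ * N)) := by
    have e : Nᴴ * (matSqrt ρ * matSqrt ρ) * N = Nᴴ * matSqrt ρ * (matSqrt ρ * N) := by
      simp only [Matrix.mul_assoc]
    rw [matSqrt_mul_self hρ] at e
    rw [Matrix.conjTranspose_mul, pr.isHermitian.eq, ← e, Matrix.mul_assoc, sub_mul,
      Matrix.smul_mul, hMN, smul_zero, zero_sub, Matrix.mul_neg, Matrix.mul_assoc]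
  have h3 := (Matrix.posSemidef_conjTranspose_mul_self (matSqrt ρ * N)).trace_nonneg
  rw [h2, Matrix.trace_neg, neg_nonneg] at h1
  have h4 := Matrix.trace_conjTranspose_mul_self_eq_zero_iff.1 (le_antisymm h1 h3)
  rw [← matSqrt_mul_self hρ, Matrix.mul_assoc, h4, Matrix.mul_zero]

variable {ρ S T : Matrix d d ℂ} {c : ℝ}

lemma mul_pinv_mul_eq_self (hρ : ρ.PosSemidef) (hS : S.IsHermitian) (hT : T.IsHermitian)
    (hSTS : S * T * S = S) (h : (c • (S * S) - ρ).PosSemidef) : S * T * ρ = ρ := by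
  have h1 := mul_eq_zero_of_smul_sub_posSemidef (N := 1 - T * S) hρ h (by
    rw [mul_sub, Matrix.mul_one, Matrix.mul_assoc, ← Matrix.mul_assoc S T S, hSTS, sub_self])
  rw [mul_sub, Matrix.mul_one, sub_eq_zero] at h1
  have h2 := congrArg Matrix.conjTranspose h1
  rw [Matrix.conjTranspose_mul, Matrix.conjTranspose_mul, hS.eq, hT.eq, hρ.isHermitian.eq] at h2
  exact h2.symm

/-- Second-moment bound for the relative density `T * ρ * T` of `ρ` with respect to `S * S`. -/
lemma trace_conjTranspose_mul_self_pinv_le (hρ : IsDensityMatrix ρ) (hS : S.IsHermitian)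
    (hT : T.IsHermitian) (hTS : T * S = S * T) (hSTS : S * T * S = S)
    (hSS : (S * S).trace = 1) (hc : 0 ≤ c) (h : (c • (S * S) - ρ).PosSemidef) :
    ((T * ρ - S)ᴴ * (T * ρ - S)).trace.re ≤ c := by
  have hSTρ := mul_pinv_mul_eq_self hρ.1 hS hT hSTS h
  have hρTS : ρ * (T * S) = ρ := by
    have h2 := congrArg Matrix.conjTranspose hSTρ
    rwa [Matrix.conjTranspose_mul, Matrix.conjTranspose_mul, hS.eq, hT.eq,
      hρ.1.isHermitian.eq] at h2
  have hG : (T * ρ * T).PosSemidef := by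
    simpa [hT.eq] using hρ.1.conjTranspose_mul_mul_same T
  have hE : (1 - T * S).PosSemidef := by
    have e : (1 - T * S)ᴴ * (1 - T * S) = 1 - T * S := by
      rw [Matrix.conjTranspose_sub, Matrix.conjTranspose_one, Matrix.conjTranspose_mul, hS.eq,
        hT.eq, ← hTS, mul_sub, Matrix.mul_one, sub_mul, Matrix.one_mul, Matrix.mul_assoc,
        ← Matrix.mul_assoc S, hSTS, sub_self, sub_zero]
    rw [← e]
    exact Matrix.posSemidef_conjTranspose_mul_self _
  have hcG : (c • (1 : Matrix d d ℂ) - T * ρ * T).PosSemidef := by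
    have h1 := h.conjTranspose_mul_mul_same T
    have e : c • (1 : Matrix d d ℂ) - T * ρ * T =
        Tᴴ * (c • (S * S) - ρ) * T + c • (1 - T * S) := by
      have : T * (S * S) * T = T * S := by
        rw [Matrix.mul_assoc, Matrix.mul_assoc, ← hTS, ← Matrix.mul_assoc S, hSTS]
      rw [hT.eq, mul_sub, sub_mul, Matrix.mul_smul, Matrix.smul_mul, this, smul_sub]
      abel
    rw [e]
    exact h1.add (hE.smul hc)
  set G := T * ρ * T with hGdef
  have pR := posSemidef_matSqrt hG
  have hRR := matSqrt_mul_self hG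
  have h1 := trace_re_nonneg (hcG.conjTranspose_mul_mul_same (matSqrt G * S))
  have hSGS : S * G * S = ρ := by
    rw [hGdef]
    calc S * (T * ρ * T) * S = S * T * (ρ * (T * S)) := by simp only [Matrix.mul_assoc]
      _ = ρ := by rw [hρTS, hSTρ]
  have hTρ : T * ρ = G * S := by
    rw [hGdef, Matrix.mul_assoc, Matrix.mul_assoc, hρTS]
  have e1 : (matSqrt G * S)ᴴ * (c • (1 : Matrix d d ℂ) - G) * (matSqrt G * S) =
      c • ρ - (T * ρ)ᴴ * (T * ρ) := by
    have e2 : (matSqrt G * S)ᴴ * (matSqrt G * S) = ρ := by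
      rw [Matrix.conjTranspose_mul, pR.isHermitian.eq, hS.eq]
      calc S * matSqrt G * (matSqrt G * S) = S * (matSqrt G * matSqrt G) * S := by
            simp only [Matrix.mul_assoc]
        _ = ρ := by rw [hRR, hSGS]
    have e3 : (matSqrt G * S)ᴴ * G * (matSqrt G * S) = (T * ρ)ᴴ * (T * ρ) := by
      rw [hTρ, Matrix.conjTranspose_mul, Matrix.conjTranspose_mul, pR.isHermitian.eq, hS.eq,
        hG.isHermitian.eq]
      calc S * matSqrt G * G * (matSqrt G * S)
          = S * matSqrt G * (matSqrt G * matSqrt G) * (matSqrt G * S) := by rw [hRR]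
        _ = S * (matSqrt G * matSqrt G) * (matSqrt G * matSqrt G * S) := by
          simp only [Matrix.mul_assoc]
        _ = S * G * (G * S) := by rw [hRR]
    rw [mul_sub, sub_mul, e3, Matrix.mul_smul, Matrix.smul_mul, Matrix.mul_one, e2]
  rw [e1, Matrix.trace_sub, Matrix.trace_smul, hρ.2, Complex.sub_re, Complex.smul_re,
    Complex.one_re, smul_eq_mul, mul_one] at h1
  have e4 : ((T * ρ - S)ᴴ * (T * ρ - S)).trace = ((T * ρ)ᴴ * (T * ρ)).trace - 1 := by
    have e5 : (T * ρ)ᴴ * S = ρ := by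
      rw [Matrix.conjTranspose_mul, hT.eq, hρ.1.isHermitian.eq, Matrix.mul_assoc, hρTS]
    have e6 : S * (T * ρ) = ρ := by rw [← Matrix.mul_assoc, hSTρ]
    rw [Matrix.conjTranspose_sub, hS.eq, sub_mul, mul_sub, mul_sub, e5, e6]
    simp only [Matrix.trace_sub, hρ.2, hSS]
    ring
  rw [e4, Complex.sub_re, Complex.one_re]
  linarith

end SecondMoment

section ConvexSplitBound

variable {P Q : Type*} [Fintype P] [Fintype Q]

lemma ptrace2_kronecker_one_mul [DecidableEq Q] (A : Matrix P P ℂ) (M : Matrix (P × Q) (P × Q) ℂ) :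
    ptrace2 ((A ⊗ₖ (1 : Matrix Q Q ℂ)) * M) = A * ptrace2 M := by
  ext p p'
  simp only [ptrace2, Matrix.mul_apply, Fintype.sum_prod_type, Matrix.kroneckerMap_apply,
    Matrix.one_apply, mul_ite, ite_mul, mul_one, mul_zero, zero_mul, Finset.sum_ite_eq,
    Finset.mem_univ, if_true, Finset.mul_sum]
  exact Finset.sum_comm

lemma sum_star_mul_eq_ptrace2 [DecidableEq P] {z : Matrix Q Q ℂ} (hz : z.IsHermitian)
    (M : Matrix (P × Q) (P × Q) ℂ) (p p' : P) :
    ∑ q', ∑ q, star (z q q') * M (p, q) (p', q') =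
      ptrace2 (((1 : Matrix P P ℂ) ⊗ₖ z) * M) p p' := by
  simp only [ptrace2, Matrix.mul_apply, Fintype.sum_prod_type, Matrix.kroneckerMap_apply,
    Matrix.one_apply, ite_mul, one_mul, zero_mul]
  refine Finset.sum_congr rfl fun q' _ => ?_
  rw [Finset.sum_comm]
  simp only [Finset.sum_ite_eq, Finset.mem_univ, if_true, hz.apply]

variable [DecidableEq P] [DecidableEq Q] {n : ℕ}

/-- The convex-split state is close to the product state when the marginal is dominated. -/
lemma norm_trace_mul_convexSplit_sub_sq_le {ρ : Matrix (P × Q) (P × Q) ℂ} {A : Matrix P P ℂ}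
    {σ : Matrix Q Q ℂ} (hρ : IsDensityMatrix ρ) (hA : ptrace2 ρ = A) (hσ : IsDensityMatrix σ)
    {c : ℝ} (hc : 0 ≤ c) (h : (c • (A ⊗ₖ σ) - ρ).PosSemidef) (hn : n ≠ 0)
    {U : Matrix (P × (Fin n → Q)) (P × (Fin n → Q)) ℂ} (hU : Uᴴ * U = 1) :
    ‖(U * (convexSplit ρ σ n - A ⊗ₖ tensorPow n σ)).trace‖ ^ 2 ≤ c / n := by
  have hAd : IsDensityMatrix A := hA ▸ hρ.ptrace2
  obtain ⟨u, hu, hux, hxux⟩ := exists_matSqrt_pinv hAd.1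
  obtain ⟨v, hv, hvz, hzvz⟩ := exists_matSqrt_pinv hσ.1
  have hx := (posSemidef_matSqrt hAd.1).isHermitian
  have hz := (posSemidef_matSqrt hσ.1).isHermitian
  have hxx := matSqrt_mul_self hAd.1
  have hzz := matSqrt_mul_self hσ.1
  set x := matSqrt A
  set z := matSqrt σ
  have hS : (x ⊗ₖ z).IsHermitian := by
    rw [Matrix.IsHermitian, Matrix.conjTranspose_kronecker, hx.eq, hz.eq]
  have hT : (u ⊗ₖ v).IsHermitian := by
    rw [Matrix.IsHermitian, Matrix.conjTranspose_kronecker, hu.eq, hv.eq]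
  have hSS : (x ⊗ₖ z) * (x ⊗ₖ z) = A ⊗ₖ σ := by
    rw [← Matrix.mul_kronecker_mul, hxx, hzz]
  have hTS : (u ⊗ₖ v) * (x ⊗ₖ z) = (x ⊗ₖ z) * (u ⊗ₖ v) := by
    rw [← Matrix.mul_kronecker_mul, ← Matrix.mul_kronecker_mul, hux, hvz]
  have hSTS : (x ⊗ₖ z) * (u ⊗ₖ v) * (x ⊗ₖ z) = x ⊗ₖ z := by
    rw [← Matrix.mul_kronecker_mul, ← Matrix.mul_kronecker_mul, hxux, hzvz]
  have h' : (c • ((x ⊗ₖ z) * (x ⊗ₖ z)) - ρ).PosSemidef := by rwa [hSS]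
  have hSTρ := mul_pinv_mul_eq_self hρ.1 hS hT hSTS h'
  have hdA := hAd.kronecker hσ
  have hKc := trace_conjTranspose_mul_self_pinv_le hρ hS hT hTS hSTS
    (by rw [hSS]; exact hdA.2) hc h'
  have hzvρ : ((1 : Matrix P P ℂ) ⊗ₖ (z * v)) * ρ = ρ := by
    conv_lhs => rw [← hSTρ]
    rw [← Matrix.mul_assoc, ← Matrix.mul_kronecker_mul, ← Matrix.mul_kronecker_mul,
      Matrix.one_mul, ← Matrix.mul_assoc, hzvz, Matrix.mul_kronecker_mul, hSTρ]
  have hptr : ptrace2 (((1 : Matrix P P ℂ) ⊗ₖ z) * ((u ⊗ₖ v) * ρ - x ⊗ₖ z)) = 0 := by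
    have e1 : ((1 : Matrix P P ℂ) ⊗ₖ z) * ((u ⊗ₖ v) * ρ) = (u ⊗ₖ (1 : Matrix Q Q ℂ)) * ρ := by
      conv_rhs => rw [← hzvρ]
      rw [← Matrix.mul_assoc, ← Matrix.mul_assoc, ← Matrix.mul_kronecker_mul,
        ← Matrix.mul_kronecker_mul, Matrix.one_mul, Matrix.mul_one, Matrix.one_mul]
    have e2 : ptrace2 ((u ⊗ₖ (1 : Matrix Q Q ℂ)) * ρ) = x := by
      rw [ptrace2_kronecker_one_mul, hA, ← hxx, ← Matrix.mul_assoc, hux, hxux]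
    have e3 : ptrace2 (((1 : Matrix P P ℂ) ⊗ₖ z) * (x ⊗ₖ z)) = x := by
      rw [← Matrix.mul_kronecker_mul, Matrix.one_mul, hzz, ptrace2_kronecker, hσ.2, one_smul]
    have e4 : ∀ M N : Matrix (P × Q) (P × Q) ℂ, ptrace2 (M - N) = ptrace2 M - ptrace2 N := by
      intro M N
      ext i j
      simp [ptrace2]
    rw [mul_sub, e4, e1, e2, e3, sub_self]
  set K := (u ⊗ₖ v) * ρ - x ⊗ₖ z with hK
  have hSK : (x ⊗ₖ z) * K = ρ - A ⊗ₖ σ := by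
    rw [hK, mul_sub, hSS, ← Matrix.mul_assoc, hSTρ]
  have hn' : (n : ℂ) ≠ 0 := Nat.cast_ne_zero.2 hn
  set Z : Matrix (P × (Fin n → Q)) (P × (Fin n → Q)) ℂ :=
    ((n : ℂ)⁻¹) • ∑ j : Fin n, blockState K z n j with hZ
  set W : Matrix (P × (Fin n → Q)) (P × (Fin n → Q)) ℂ := x ⊗ₖ tensorPow n z with hW
  have hWj : ∀ j, W = blockState (x ⊗ₖ z) z n j := fun j => (blockState_kronecker x z j).symm
  have hWZ : W * Z = convexSplit ρ σ n - A ⊗ₖ tensorPow n σ := by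
    rw [hZ, Matrix.mul_smul, Matrix.mul_sum, convexSplit]
    have : ∀ j ∈ Finset.univ, W * blockState K z n j =
        blockState ρ σ n j - A ⊗ₖ tensorPow n σ := fun j _ => by
      rw [hWj j, blockState_mul, hSK, hzz, blockState_sub, blockState_kronecker]
    rw [Finset.sum_congr rfl this, Finset.sum_sub_distrib, smul_sub]
    congr 1
    rw [Finset.sum_const, Finset.card_univ, Fintype.card_fin, ← Nat.cast_smul_eq_nsmul ℂ,
      smul_smul, inv_mul_cancel₀ hn', one_smul]
  have hzz1 : (zᴴ * z).trace = 1 := by rw [hz.eq, hzz, hσ.2]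
  have hWW : (Wᴴ * W).trace = 1 := by
    rw [hWj ⟨0, Nat.pos_of_ne_zero hn⟩, trace_conjTranspose_blockState_mul_self _ _ hzz1, hS.eq,
      hSS, hdA.2]
  have hZZ : (Zᴴ * Z).trace = (n : ℂ)⁻¹ * (Kᴴ * K).trace := by
    have e : ∀ i j : Fin n, ((blockState K z n i)ᴴ * blockState K z n j).trace =
        if i = j then (Kᴴ * K).trace else 0 := by
      intro i j
      split_ifs with hij
      · rw [hij, trace_conjTranspose_blockState_mul_self _ _ hzz1]
      · exact trace_conjTranspose_blockState_mul_of_ne _ _ (fun p p' => by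
          rw [sum_star_mul_eq_ptrace2 hz, hptr]; rfl) hij
    rw [hZ, Matrix.conjTranspose_smul, Matrix.conjTranspose_sum, Matrix.smul_mul,
      Matrix.mul_smul, Matrix.sum_mul]
    simp only [Matrix.mul_sum, Matrix.trace_smul, Matrix.trace_sum, e, Finset.sum_ite_eq,
      Finset.mem_univ, if_true, Finset.sum_const, Finset.card_univ, Fintype.card_fin,
      nsmul_eq_mul, smul_eq_mul, star_inv₀, star_natCast]
    field_simp
  have hCS := norm_trace_conjTranspose_mul_sq_le (U * W)ᴴ Z
  have hUW : ((U * W) * (U * W)ᴴ).trace = 1 := by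
    rw [Matrix.trace_mul_comm, Matrix.conjTranspose_mul, Matrix.mul_assoc, ← Matrix.mul_assoc Uᴴ,
      hU, Matrix.one_mul, hWW]
  rw [Matrix.conjTranspose_conjTranspose, hUW, hZZ, Matrix.mul_assoc, hWZ, Complex.one_re,
    one_mul] at hCS
  refine hCS.trans ?_
  rw [← Complex.ofReal_natCast, ← Complex.ofReal_inv, Complex.re_ofReal_mul, inv_mul_eq_div]
  exact div_le_div_of_nonneg_right hKc (Nat.cast_nonneg n)

lemma one_sub_sqrt_le_fidelity_convexSplit {ρ : Matrix (P × Q) (P × Q) ℂ}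
    {σ : Matrix Q Q ℂ} (hρ : IsDensityMatrix ρ) (hσ : IsDensityMatrix σ)
    {c : ℝ} (hc : 0 ≤ c) (h : (c • (ptrace2 ρ ⊗ₖ σ) - ρ).PosSemidef) (hn : n ≠ 0) :
    1 - Real.sqrt (c / n) ≤ fidelity
      (ptrace2 (convexSplit ρ σ n) ⊗ₖ ptrace1 (convexSplit ρ σ n)) (convexSplit ρ σ n) := by
  have hτ := isDensityMatrix_convexSplit hρ hσ hn
  refine one_sub_le_fidelity_of_unitary_bound (hτ.ptrace2.kronecker hτ.ptrace1) hτ fun U hU => ?_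
  rw [ptrace2_convexSplit ρ hσ.2 hn, kronecker_ptrace1_convexSplit]
  have hσQ := posSemidef_smul_sub_ptrace1 hρ.ptrace2.2 h
  have h2 : (c • (ptrace2 ρ ⊗ₖ σ) - ptrace2 ρ ⊗ₖ ptrace1 ρ).PosSemidef := by
    have := hρ.ptrace2.1.kronecker hσQ
    have e : ptrace2 ρ ⊗ₖ (c • σ - ptrace1 ρ) =
        c • (ptrace2 ρ ⊗ₖ σ) - ptrace2 ρ ⊗ₖ ptrace1 ρ := by
      ext i j
      simp [mul_sub, mul_left_comm]
    rwa [e] at this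
  have b1 := Real.le_sqrt_of_sq_le
    (norm_trace_mul_convexSplit_sub_sq_le hρ rfl hσ hc h hn hU)
  have b2 := Real.le_sqrt_of_sq_le (norm_trace_mul_convexSplit_sub_sq_le
    (hρ.ptrace2.kronecker hρ.ptrace1) (by rw [ptrace2_kronecker, hρ.ptrace1.2, one_smul])
    hσ hc h2 hn hU)
  have e : (U * (convexSplit (ptrace2 ρ ⊗ₖ ptrace1 ρ) σ n - convexSplit ρ σ n)).trace =
      (U * (convexSplit (ptrace2 ρ ⊗ₖ ptrace1 ρ) σ n - ptrace2 ρ ⊗ₖ tensorPow n σ)).trace -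
      (U * (convexSplit ρ σ n - ptrace2 ρ ⊗ₖ tensorPow n σ)).trace := by
    rw [← Matrix.trace_sub, ← mul_sub, sub_sub_sub_cancel_right]
  rw [e]
  linarith [norm_sub_le
    (U * (convexSplit (ptrace2 ρ ⊗ₖ ptrace1 ρ) σ n - ptrace2 ρ ⊗ₖ tensorPow n σ)).trace
    (U * (convexSplit ρ σ n - ptrace2 ρ ⊗ₖ tensorPow n σ)).trace]

lemma two_sub_le_fidelity_convexSplit_one {ρ : Matrix (P × Q) (P × Q) ℂ}
    {σ : Matrix Q Q ℂ} (hρ : IsDensityMatrix ρ) (hσ : IsDensityMatrix σ)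
    {c : ℝ} (hc : 0 ≤ c) (h : (c • (ptrace2 ρ ⊗ₖ σ) - ρ).PosSemidef) :
    2 - c ≤ fidelity
      (ptrace2 (convexSplit ρ σ 1) ⊗ₖ ptrace1 (convexSplit ρ σ 1)) (convexSplit ρ σ 1) := by
  refine two_sub_le_fidelity_of_le (isDensityMatrix_convexSplit hρ hσ one_ne_zero)
    (s := σ.submatrix (fun x : Fin 1 → Q => x 0) (fun x => x 0)) ⟨hσ.1.submatrix _, ?_⟩ hc ?_
  · rw [← hσ.2]
    exact Fintype.sum_equiv (Equiv.funUnique (Fin 1) Q) _ _ fun _ => rfl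
  · rw [ptrace2_convexSplit ρ hσ.2 one_ne_zero]
    convert h.submatrix (fun x : P × (Fin 1 → Q) => (x.1, x.2 0)) using 1
    ext x y
    simp [convexSplit, blockState]

end ConvexSplitBound

/-- Every exponent above `Dmax` realizes the Loewner domination. -/
lemma posSemidef_smul_sub_of_dmax_lt {d : Type*} [Fintype d] {ρ ω : Matrix d d ℂ}
    (hω : ω.PosSemidef) {l : ℝ} (h : dmax ρ ω < (l : EReal)) :
    (((2 : ℝ) ^ l) • ω - ρ).PosSemidef := by
  obtain ⟨_, ⟨l', rfl, hl'⟩, hlt⟩ := sInf_lt_iff.1 h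
  have hle : (2 : ℝ) ^ l' ≤ (2 : ℝ) ^ l :=
    Real.rpow_le_rpow_of_exponent_le one_le_two (EReal.coe_lt_coe_iff.1 hlt).le
  have hl'' : (((2 : ℝ) ^ l') • ω - ρ).PosSemidef := hl'
  have := hl''.add (hω.smul (sub_nonneg.2 hle))
  rwa [sub_smul, sub_add_sub_comm, add_comm, add_sub_add_right_eq_sub] at this

/-- **Convex-split lemma (fidelity bound).**
Let δ ∈ (0, 1/6), ρ_PQ a density matrix on P×Q, σ_Q a density matrix on Q with
k := Dmax(ρ_PQ ‖ ρ_P ⊗ σ_Q) finite.  With n := 1 if k ≤ 3δ and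
n := ⌈8·2^k·log(k/δ)/δ³⌉ otherwise, the convex-split state τ satisfies
F(τ_P ⊗ τ_{Q₁…Qₙ}, τ)² ≥ 1 − 6δ. -/
theorem convex_split_fidelity {P Q : Type} [Fintype P] [Fintype Q]
    [DecidableEq P] [DecidableEq Q] [Nonempty P] [Nonempty Q]
    (δ : ℝ) (hδ0 : 0 < δ) (hδ1 : δ < 1 / 6)
    (ρ : Matrix (P × Q) (P × Q) ℂ) (hρ : IsDensityMatrix ρ)
    (σ : Matrix Q Q ℂ) (hσ : IsDensityMatrix σ)
    (k : ℝ) (hk : dmax ρ (ptrace2 ρ ⊗ₖ σ) = (k : EReal))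
    (n : ℕ)
    (hn : n = if k ≤ 3 * δ then 1 else ⌈8 * (2 : ℝ) ^ k * Real.logb 2 (k / δ) / δ ^ 3⌉₊) :
    (fidelity
        (ptrace2 (convexSplit ρ σ n) ⊗ₖ ptrace1 (convexSplit ρ σ n))
        (convexSplit ρ σ n)) ^ 2 ≥ 1 - 6 * δ := by
  have hdom : ∀ l : ℝ, k < l → (((2 : ℝ) ^ l) • (ptrace2 ρ ⊗ₖ σ) - ρ).PosSemidef := fun l hl =>
    posSemidef_smul_sub_of_dmax_lt (hρ.ptrace2.kronecker hσ).1
      (by rw [hk]; exact EReal.coe_lt_coe_iff.2 hl)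
  suffices hF : 1 - 3 * δ ≤ fidelity
      (ptrace2 (convexSplit ρ σ n) ⊗ₖ ptrace1 (convexSplit ρ σ n)) (convexSplit ρ σ n) by
    nlinarith
  by_cases hkδ : k ≤ 3 * δ
  · rw [if_pos hkδ] at hn
    subst hn
    have hlim : (2 : ℝ) - 2 ^ k ≤ fidelity
        (ptrace2 (convexSplit ρ σ 1) ⊗ₖ ptrace1 (convexSplit ρ σ 1)) (convexSplit ρ σ 1) := by
      have ht : Filter.Tendsto (fun l : ℝ => (2 : ℝ) - 2 ^ l) (nhdsWithin k (Set.Ioi k))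
          (nhds (2 - 2 ^ k)) :=
        (continuous_const.sub (Real.continuous_const_rpow two_ne_zero)).continuousAt.mono_left
          nhdsWithin_le_nhds
      refine le_of_tendsto ht ?_
      filter_upwards [self_mem_nhdsWithin] with l hl
      exact two_sub_le_fidelity_convexSplit_one hρ hσ (Real.rpow_nonneg zero_le_two l) (hdom l hl)
    have h1 : (2 : ℝ) ^ k ≤ 2 ^ (3 * δ) := Real.rpow_le_rpow_of_exponent_le one_le_two hkδ
    have h2 := rpow_one_add_le_one_add_mul_self (s := 1) (by norm_num)
      (show 0 ≤ 3 * δ by positivity) (by linarith)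
    norm_num at h2
    linarith
  · rw [if_neg hkδ] at hn
    push Not at hkδ
    have hlog : 1 ≤ Real.logb 2 (k / δ) := by
      rw [Real.le_logb_iff_rpow_le one_lt_two (by apply div_pos <;> linarith), Real.rpow_one,
        le_div_iff₀ hδ0]
      linarith
    have hpos : 0 < (2 : ℝ) ^ k := Real.rpow_pos_of_pos two_pos k
    have hnR : 8 * (2 : ℝ) ^ k / δ ^ 3 ≤ n := by
      rw [hn]
      refine le_trans ?_ (Nat.le_ceil _)
      rw [div_le_div_iff_of_pos_right (by positivity)]
      exact le_mul_of_one_le_right (by positivity) hlog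
    have hn0 : (0 : ℝ) < n := lt_of_lt_of_le (by positivity) hnR
    have hF := one_sub_sqrt_le_fidelity_convexSplit hρ hσ
      (Real.rpow_nonneg zero_le_two (k + 1)) (hdom (k + 1) (lt_add_one k))
      (Nat.cast_ne_zero.1 hn0.ne')
    have hsq : Real.sqrt ((2 : ℝ) ^ (k + 1) / n) ≤ δ := by
      refine Real.sqrt_le_iff.2 ⟨hδ0.le, ?_⟩
      rw [div_le_iff₀ (by positivity)] at hnR
      rw [div_le_iff₀ hn0, Real.rpow_add_one two_ne_zero]
      have : n * δ ^ 3 ≤ δ ^ 2 * n := by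
        have h0 : 0 ≤ δ ^ 2 * n := by positivity
        nlinarith
      linarith
    linarith

end
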